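/- For every metric space (X,d) and every ε ∈ (0,1), the Lipschitz dimension does not increase under snowflaking: dim_L(X,d^ε) ≤ dim_L(X,d). -/

import Mathlib

open Metric Set
open scoped ENNReal NNReal

/-- `l` is an `r`-path (consecutive distances at most `r`) lying in the set `S`. -/
def IsRPathIn {X : Type*} [PseudoMetricSpace X] (r : ℝ) (S : Set X) (l : List X) : Prop :=
  (∀ z ∈ l, z ∈ S) ∧ l.Chain' (fun a b => dist a b ≤ r)

/-- `x` and `y` lie in the same `r`-component of `S`: they are joined by an `r`-path in `S`. -/
def SameRComponent {X : Type*} [PseudoMetricSpace X] (r : ℝ) (S : Set X) (x y : X) : Prop :=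
  ∃ l : List X, IsRPathIn r S l ∧ l.head? = some x ∧ l.getLast? = some y

/-- `f` is Lipschitz light with constant `C`: it is `C`-Lipschitz and, for every `r > 0` and
every `W ⊆ Y` with `diam W ≤ r`, every `r`-component of `f ⁻¹' W` has diameter at most `C * r`. -/
def LipschitzLightWith {X Y : Type*} [PseudoMetricSpace X] [PseudoMetricSpace Y]
    (C : ℝ) (f : X → Y) : Prop :=
  (∀ x y : X, dist (f x) (f y) ≤ C * dist x y) ∧
  ∀ r : ℝ, 0 < r → ∀ W : Set Y, EMetric.diam W ≤ ENNReal.ofReal r →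
    ∀ x y : X, SameRComponent r (f ⁻¹' W) x y → dist x y ≤ C * r

/-- The Lipschitz dimension of a metric space: the least `n` such that there is a
Lipschitz light map `X → ℝⁿ`, and `⊤` if there is none. -/
noncomputable def lipschitzDim (X : Type*) [PseudoMetricSpace X] : ℕ∞ :=
  sInf ((fun n : ℕ => (n : ℕ∞)) ''
    {n : ℕ | ∃ (C : ℝ), 0 < C ∧ ∃ f : X → EuclideanSpace ℝ (Fin n), LipschitzLightWith C f})

/-- The snowflake metric space `(X, d^ε)`. -/
noncomputable def Snowflake {X : Type*} (m : MetricSpace X) {ε : ℝ}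
    (h0 : 0 < ε) (h1 : ε ≤ 1) : MetricSpace X :=
  letI := m
  { dist := fun x y => dist x y ^ ε
    dist_self := fun x => by simp [Real.zero_rpow h0.ne']
    dist_comm := fun x y => by simp only [dist_comm]
    dist_triangle := fun x y z => by
      calc dist x z ^ ε ≤ (dist x y + dist y z) ^ ε :=
            Real.rpow_le_rpow dist_nonneg (dist_triangle x y z) h0.le
        _ ≤ dist x y ^ ε + dist y z ^ ε := by
            have h := NNReal.rpow_add_le_add_rpow (Real.toNNReal (dist x y))
              (Real.toNNReal (dist y z)) h0.le h1
            have h2 : ((Real.toNNReal (dist x y) + Real.toNNReal (dist y z) : ℝ≥0) : ℝ) ^ ε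
                ≤ ((Real.toNNReal (dist x y) : ℝ)) ^ ε + ((Real.toNNReal (dist y z) : ℝ)) ^ ε := by
              exact_mod_cast h
            simpa [Real.coe_toNNReal _ dist_nonneg] using h2
    eq_of_dist_eq_zero := fun {x y} h => by
      have : dist x y = 0 := (Real.rpow_eq_zero dist_nonneg h0.ne').mp h
      exact eq_of_dist_eq_zero this }

/-- The distance from a real number to the nearest integer. -/
noncomputable def distInt (x : ℝ) : ℝ := |x - round x|

lemma distInt_nonneg (x : ℝ) : 0 ≤ distInt x := abs_nonneg _

lemma distInt_le_half (x : ℝ) : distInt x ≤ 1 / 2 := abs_sub_round x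

lemma distInt_intCast (m : ℤ) : distInt m = 0 := by simp [distInt]

lemma distInt_intCast_add_half (m : ℤ) : distInt (m + 1 / 2) = 1 / 2 := by
  have h : round ((m : ℝ) + 1 / 2) = m + 1 := by
    rw [round_eq, show (m : ℝ) + 1 / 2 + 1 / 2 = ((m + 1 : ℤ) : ℝ) by push_cast; ring,
      Int.floor_intCast]
  rw [distInt, h, show (m : ℝ) + 1 / 2 - ((m + 1 : ℤ) : ℝ) = -(1 / 2) by push_cast; ring, abs_neg,
    abs_of_pos (by norm_num)]

lemma abs_distInt_sub_le_half (x y : ℝ) : |distInt x - distInt y| ≤ 1 / 2 := by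
  have := distInt_nonneg x
  have := distInt_nonneg y
  have := distInt_le_half x
  have := distInt_le_half y
  rw [abs_le]
  constructor <;> linarith

lemma distInt_sub_le (x y : ℝ) : distInt x - distInt y ≤ |x - y| := by
  have h : distInt x ≤ |x - round y| := round_le x (round y)
  have h' := abs_sub_le x y (round y)
  unfold distInt at *
  linarith

lemma abs_distInt_sub_le (x y : ℝ) : |distInt x - distInt y| ≤ |x - y| := by
  rw [abs_sub_le_iff]
  exact ⟨distInt_sub_le x y, abs_sub_comm x y ▸ distInt_sub_le y x⟩

lemma hasSum_ninth_pow_natAbs (k : ℤ) :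
    HasSum (fun j : ℤ => (1 / 9 : ℝ) ^ (j - k).natAbs) (5 / 4) := by
  have hg : HasSum (fun n : ℕ => (1 / 9 : ℝ) ^ n) (9 / 8) := by
    have h := hasSum_geometric_of_lt_one (r := (1 / 9 : ℝ)) (by norm_num) (by norm_num)
    have h98 : (1 - 1 / 9 : ℝ)⁻¹ = 9 / 8 := by norm_num
    rwa [h98] at h
  have hneg : (fun n : ℕ => (1 / 9 : ℝ) ^ (-((n : ℤ) + 1)).natAbs)
      = fun n : ℕ => 1 / 9 * (1 / 9 : ℝ) ^ n := by
    funext n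
    have hn : (-((n : ℤ) + 1)).natAbs = n + 1 := by omega
    rw [hn, pow_succ']
  have hpos : (fun n : ℕ => (1 / 9 : ℝ) ^ (n : ℤ).natAbs) = fun n : ℕ => (1 / 9 : ℝ) ^ n := by
    funext n
    rw [Int.natAbs_natCast]
  have h0 := HasSum.of_nat_of_neg_add_one (f := fun i : ℤ => (1 / 9 : ℝ) ^ i.natAbs)
    (hpos ▸ hg) (hneg ▸ hg.mul_left (1 / 9))
  have h54 : (9 / 8 + 1 / 9 * (9 / 8) : ℝ) = 5 / 4 := by norm_num
  rw [h54] at h0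
  exact (Equiv.hasSum_iff (f := fun i : ℤ => (1 / 9 : ℝ) ^ i.natAbs) (Equiv.subRight k)).mpr h0

/-- The general term of the two-sided Takagi-type series
`∑ j, A ^ (-j) * distInt ((A * B) ^ j * x)`. -/
noncomputable def takagiTerm (A B : ℝ) (x : ℝ) (j : ℤ) : ℝ :=
  A ^ (-j) * distInt ((A * B) ^ j * x)

/-- The two-sided Takagi-type function `x ↦ ∑ j, A ^ (-j) * distInt ((A * B) ^ j * x)`. -/
noncomputable def takagi (A B : ℝ) (x : ℝ) : ℝ := ∑' j : ℤ, takagiTerm A B x j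

lemma zpow_neg_natCast_le {A : ℝ} (hA : 9 ≤ A) (i : ℕ) : A ^ (-(i : ℤ)) ≤ (1 / 9) ^ i := by
  rw [zpow_neg, zpow_natCast, ← inv_pow]
  gcongr
  rw [one_div]
  gcongr

lemma abs_takagiTerm_sub_le {A B M : ℝ} (hA : 9 ≤ A) (hB : 9 ≤ B) (hM : 1 / 2 ≤ M) (k : ℤ)
    {x y : ℝ} (hxy : (A * B) ^ k * |x - y| ≤ M) (j : ℤ) :
    |takagiTerm A B x j - takagiTerm A B y j| ≤ A ^ (-k) * M * (1 / 9) ^ (j - k).natAbs := by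
  have hA0 : 0 < A := by linarith
  have hB0 : 0 < B := by linarith
  rw [takagiTerm, takagiTerm, ← mul_sub, abs_mul, abs_of_pos (zpow_pos hA0 _)]
  rcases le_total k j with h | h
  · obtain ⟨i, hi⟩ := Int.eq_ofNat_of_zero_le (sub_nonneg.mpr h)
    obtain rfl : j = k + i := by omega
    rw [show (k + (i : ℤ) - k).natAbs = i by omega, neg_add, zpow_add₀ hA0.ne', mul_assoc,
      mul_assoc, mul_comm M]
    have h1 := zpow_neg_natCast_le hA i
    have h2 := (abs_distInt_sub_le_half ((A * B) ^ (k + (i : ℤ)) * x)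
      ((A * B) ^ (k + (i : ℤ)) * y)).trans hM
    gcongr
  · obtain ⟨i, hi⟩ := Int.eq_ofNat_of_zero_le (sub_nonneg.mpr h)
    obtain rfl : j = k - i := by omega
    rw [show (k - (i : ℤ) - k).natAbs = i by omega]
    have h1 := zpow_neg_natCast_le hB i
    calc A ^ (-(k - (i : ℤ))) * |distInt ((A * B) ^ (k - (i : ℤ)) * x)
          - distInt ((A * B) ^ (k - (i : ℤ)) * y)|
        ≤ A ^ (-(k - (i : ℤ))) * |(A * B) ^ (k - (i : ℤ)) * x - (A * B) ^ (k - (i : ℤ)) * y| := by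
          exact mul_le_mul_of_nonneg_left (abs_distInt_sub_le _ _) (zpow_pos hA0 _).le
      _ = A ^ (-k) * ((A * B) ^ k * |x - y|) * B ^ (-(i : ℤ)) := by
          rw [← mul_sub, abs_mul, abs_of_pos (zpow_pos (mul_pos hA0 hB0) _), mul_zpow, mul_zpow,
            neg_sub, zpow_sub₀ hA0.ne', zpow_sub₀ hA0.ne', zpow_sub₀ hB0.ne', zpow_neg, zpow_neg]
          field_simp
      _ ≤ A ^ (-k) * M * (1 / 9) ^ i := by gcongr

lemma summable_takagiTerm {A B : ℝ} (hA : 9 ≤ A) (hB : 9 ≤ B) (x : ℝ) :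
    Summable (takagiTerm A B x) := by
  refine Summable.of_norm_bounded
    (((hasSum_ninth_pow_natAbs 0).mul_left (A ^ (-(0 : ℤ)) * max (1 / 2) |x|)).summable)
    fun j => ?_
  have h := abs_takagiTerm_sub_le hA hB (le_max_left (1 / 2) |x|) 0 (x := x) (y := 0)
    (by simp) j
  have h0 : takagiTerm A B 0 j = 0 := by simp [takagiTerm, distInt]
  rwa [h0, sub_zero] at h

lemma hasSum_takagiTerm_sub {A B : ℝ} (hA : 9 ≤ A) (hB : 9 ≤ B) (x y : ℝ) :
    HasSum (fun j => takagiTerm A B x j - takagiTerm A B y j) (takagi A B x - takagi A B y) :=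
  (summable_takagiTerm hA hB x).hasSum.sub (summable_takagiTerm hA hB y).hasSum

lemma abs_takagi_sub_le {A B : ℝ} (hA : 9 ≤ A) (hB : 9 ≤ B) (k : ℤ)
    {x y : ℝ} (hxy : (A * B) ^ k * |x - y| ≤ 1) :
    |takagi A B x - takagi A B y| ≤ 5 / 4 * A ^ (-k) := by
  rw [← (hasSum_takagiTerm_sub hA hB x y).tsum_eq]
  have h := tsum_of_norm_bounded ((hasSum_ninth_pow_natAbs k).mul_left (A ^ (-k) * 1))
    (f := fun j => takagiTerm A B x j - takagiTerm A B y j)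
    (abs_takagiTerm_sub_le hA hB (by norm_num) k hxy)
  rwa [mul_one, mul_comm] at h

lemma le_abs_takagi_sub {A B : ℝ} (hA : 9 ≤ A) (hB : 9 ≤ B) (k m : ℤ)
    {x y : ℝ} (hx : (A * B) ^ k * x = m) (hy : (A * B) ^ k * y = m + 1 / 2) :
    3 / 8 * A ^ (-k) ≤ |takagi A B x - takagi A B y| := by
  have hA0 : 0 < A := by linarith
  have hB0 : 0 < B := by linarith
  have hxy : (A * B) ^ k * |x - y| ≤ 1 / 2 := by
    rw [← abs_of_pos (zpow_pos (mul_pos hA0 hB0) k), ← abs_mul, mul_sub, hx, hy,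
      show (m : ℝ) - (m + 1 / 2) = -(1 / 2) by ring, abs_neg, abs_of_pos (by norm_num)]
  have hs := (hasSum_takagiTerm_sub hA hB x y).update k 0
  have hg := ((hasSum_ninth_pow_natAbs k).mul_left (A ^ (-k) * (1 / 2))).update k 0
  have hbound : ∀ j, ‖Function.update (fun j => takagiTerm A B x j - takagiTerm A B y j) k 0 j‖
      ≤ Function.update (fun j : ℤ => A ^ (-k) * (1 / 2) * (1 / 9) ^ (j - k).natAbs) k 0 j := by
    intro j
    rcases eq_or_ne j k with rfl | h
    · simp
    · rw [Function.update_of_ne h, Function.update_of_ne h]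
      exact abs_takagiTerm_sub_le hA hB le_rfl k hxy j
  have h1 := tsum_of_norm_bounded hg hbound
  rw [hs.tsum_eq, Real.norm_eq_abs] at h1
  have h2 : takagiTerm A B x k - takagiTerm A B y k = -(A ^ (-k) / 2) := by
    rw [takagiTerm, takagiTerm, hx, hy, distInt_intCast, distInt_intCast_add_half]
    ring
  rw [h2] at h1
  simp only [sub_self, Int.natAbs_zero, pow_zero, mul_one, zero_sub] at h1
  have h3 := (abs_le.mp h1).2
  have h4 : -(takagi A B x - takagi A B y) ≤ |takagi A B x - takagi A B y| := neg_le_abs _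
  have h5 := (abs_le.mp h1).1
  linarith

/-- For `0 < ε < 1` there is an `ε`-Hölder function on the line that oscillates by at least
`c * L ^ ε` on every interval of length `L`, at all scales. -/
theorem exists_holder_oscillating {ε : ℝ} (h0 : 0 < ε) (h1 : ε < 1) :
    ∃ (F : ℝ → ℝ) (H c : ℝ), 0 < H ∧ 0 < c ∧ (∀ x y, |F x - F y| ≤ H * |x - y| ^ ε) ∧
      ∀ a b, a < b → ∃ x ∈ Icc a b, ∃ y ∈ Icc a b, c * (b - a) ^ ε ≤ |F x - F y| := by
  have h1' : 0 < 1 - ε := sub_pos.mpr h1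
  obtain ⟨q, hq1, hA, hB⟩ : ∃ q : ℝ, 1 < q ∧ 9 ≤ q ^ ε ∧ 9 ≤ q ^ (1 - ε) := by
    refine ⟨max (9 ^ ε⁻¹) (9 ^ (1 - ε)⁻¹), lt_max_of_lt_left ?_, ?_, ?_⟩
    · exact Real.one_lt_rpow (by norm_num) (inv_pos.mpr h0)
    · rw [← Real.rpow_inv_le_iff_of_pos (by norm_num) (by positivity) h0]
      exact le_max_left _ _
    · rw [← Real.rpow_inv_le_iff_of_pos (by norm_num) (by positivity) h1']
      exact le_max_right _ _
  have hq0 : 0 < q := by linarith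
  have hAB : q ^ ε * q ^ (1 - ε) = q := by
    rw [← Real.rpow_add hq0, add_sub_cancel, Real.rpow_one]
  have hpow (k : ℤ) : (q ^ ε) ^ (-k) = (q ^ (-k)) ^ ε := by
    rw [← Real.rpow_intCast, ← Real.rpow_intCast, ← Real.rpow_mul hq0.le, ← Real.rpow_mul hq0.le,
      mul_comm]
  refine ⟨takagi (q ^ ε) (q ^ (1 - ε)), 5 / 4 * q ^ ε, 3 / 8 * ((2 * q)⁻¹) ^ ε, by positivity,
    by positivity, fun x y => ?_, fun a b hab => ?_⟩
  · rcases eq_or_ne x y with rfl | hxy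
    · simp [Real.zero_rpow h0.ne']
    have hd : 0 < |x - y| := abs_pos.mpr (sub_ne_zero.mpr hxy)
    obtain ⟨n, hn1, hn2⟩ := exists_mem_Ioc_zpow hd hq1
    have := abs_takagi_sub_le hA hB (-(n + 1)) (x := x) (y := y) (by
      rw [hAB, zpow_neg, inv_mul_le_iff₀ (zpow_pos hq0 _), mul_one]
      exact hn2)
    refine this.trans ?_
    rw [hpow, mul_assoc, ← Real.mul_rpow hq0.le hd.le, neg_neg, zpow_add_one₀ hq0.ne', mul_comm q]
    gcongr
  · have hd : 0 < (b - a) / 2 := by linarith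
    obtain ⟨n, hn1, hn2⟩ := exists_mem_Ico_zpow hd hq1
    have hqn : 0 < q ^ n := zpow_pos hq0 n
    set m := ⌈a / q ^ n⌉ with hm
    have hm1 : a ≤ m * q ^ n := (div_le_iff₀ hqn).mp (Int.le_ceil _)
    have hm2 : (m : ℝ) * q ^ n < a + q ^ n := by
      have := Int.ceil_lt_add_one (a / q ^ n)
      rw [← hm] at this
      calc (m : ℝ) * q ^ n < (a / q ^ n + 1) * q ^ n := by gcongr
        _ = a + q ^ n := by field_simp
    refine ⟨m * q ^ n, ⟨hm1, by linarith⟩, (m + 1 / 2) * q ^ n, ⟨by linarith, by linarith⟩, ?_⟩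
    refine le_trans ?_ (le_abs_takagi_sub hA hB (-n) m ?_ ?_)
    · rw [hpow, neg_neg, mul_assoc, ← Real.mul_rpow (by positivity) (by linarith)]
      have : (2 * q)⁻¹ * (b - a) ≤ q ^ n := by
        rw [inv_mul_le_iff₀ (by positivity)]
        rw [zpow_add_one₀ hq0.ne'] at hn2
        linarith
      have h3 : 0 ≤ (2 * q)⁻¹ * (b - a) := mul_nonneg (by positivity) (by linarith)
      gcongr
    · rw [hAB, zpow_neg]
      field_simp
    · rw [hAB, zpow_neg]
      field_simp

/-- A discrete intermediate value theorem along chains. -/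
lemma exists_mem_abs_sub_le_of_isChain {X : Type*} (h : X → ℝ) {s p : ℝ} (hs : 0 ≤ s) :
    ∀ l : List X, l.IsChain (fun a b => |h a - h b| ≤ s) → ∀ a ∈ l, ∀ b ∈ l, h a ≤ p → p ≤ h b →
      ∃ z ∈ l, |h z - p| ≤ s
  | [], _, a, ha, _, _, _, _ => by simp at ha
  | [c], _, a, ha, b, hb, hap, hpb => by
    rw [List.mem_singleton] at ha hb
    subst ha hb
    exact ⟨b, by simp, by rw [le_antisymm hap hpb]; simpa using hs⟩
  | c :: d :: t, hl, a, ha, b, hb, hap, hpb => by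
    rw [List.isChain_cons_cons] at hl
    have ih := exists_mem_abs_sub_le_of_isChain h (p := p) hs (d :: t) hl.2
    have lift : (∃ z ∈ d :: t, |h z - p| ≤ s) → ∃ z ∈ c :: d :: t, |h z - p| ≤ s :=
      fun ⟨z, hz, hzp⟩ => ⟨z, List.mem_cons_of_mem _ hz, hzp⟩
    have hcd := abs_le.mp hl.1
    rcases List.mem_cons.mp ha with rfl | ha' <;> rcases List.mem_cons.mp hb with rfl | hb'
    · exact ⟨b, by simp, by rw [le_antisymm hap hpb]; simpa using hs⟩
    · rcases le_total (h d) p with hd | hd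
      · exact lift (ih d (by simp) b hb' hd hpb)
      · exact ⟨a, by simp, abs_le.mpr ⟨by linarith, by linarith⟩⟩
    · rcases le_total (h d) p with hd | hd
      · exact ⟨b, by simp, abs_le.mpr ⟨by linarith, by linarith⟩⟩
      · exact lift (ih a ha' d (by simp) hap hd)
    · exact lift (ih a ha' b hb' hap hpb)

/-- For `0 < ε < 1` there is an `ε`-Hölder function `F` on the line which is light as a map from
the `ε`-snowflake: an `s`-chain along which `F` oscillates by at most `s ^ ε` has diameter at most
`K * s`. -/
theorem exists_holder_light.{u} {ε : ℝ} (h0 : 0 < ε) (h1 : ε < 1) :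
    ∃ (F : ℝ → ℝ) (H K : ℝ), 0 < H ∧ 0 < K ∧ (∀ x y, |F x - F y| ≤ H * |x - y| ^ ε) ∧
      ∀ (X : Type u) (h : X → ℝ) (s : ℝ), 0 < s → ∀ l : List X,
        l.IsChain (fun a b => |h a - h b| ≤ s) →
        (∀ a ∈ l, ∀ b ∈ l, |F (h a) - F (h b)| ≤ s ^ ε) →
        ∀ a ∈ l, ∀ b ∈ l, |h a - h b| ≤ K * s := by
  obtain ⟨F, H, c, hH, hc, hF, hosc⟩ := exists_holder_oscillating h0 h1
  refine ⟨F, H, ((2 * H + 1) / c) ^ ε⁻¹, hH, by positivity, hF, ?_⟩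
  intro X h s hs l hl hFl
  have key : ∀ a ∈ l, ∀ b ∈ l, h b - h a ≤ ((2 * H + 1) / c) ^ ε⁻¹ * s := by
    intro a ha b hb
    rcases le_or_gt (h b) (h a) with hab | hab
    · exact (sub_nonpos.mpr hab).trans (by positivity)
    obtain ⟨x, hx, y, hy, hxy⟩ := hosc _ _ hab
    have hdev : ∀ p ∈ Icc (h a) (h b), ∃ z ∈ l, |F (h z) - F p| ≤ H * s ^ ε := by
      intro p hp
      obtain ⟨z, hz, hzp⟩ := exists_mem_abs_sub_le_of_isChain h hs.le l hl a ha b hb hp.1 hp.2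
      refine ⟨z, hz, (hF _ _).trans ?_⟩
      gcongr
    obtain ⟨z, hz, hzx⟩ := hdev x hx
    obtain ⟨w, hw, hwy⟩ := hdev y hy
    have h2 : c * (h b - h a) ^ ε ≤ (2 * H + 1) * s ^ ε := by
      have := abs_sub_le (F x) (F (h z)) (F y)
      have := abs_sub_le (F (h z)) (F (h w)) (F y)
      have := hFl z hz w hw
      rw [abs_sub_comm] at hzx
      linarith
    rw [← Real.rpow_le_rpow_iff (sub_pos.mpr hab).le (by positivity) h0,
      Real.mul_rpow (by positivity) hs.le, Real.rpow_inv_rpow (by positivity) h0.ne',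
      div_mul_eq_mul_div, le_div_iff₀ hc]
    linarith
  intro a ha b hb
  rw [abs_sub_le_iff]
  exact ⟨key b hb a ha, key a ha b hb⟩

lemma EuclideanSpace.dist_le_sqrt_mul {n : ℕ} {u v : EuclideanSpace ℝ (Fin n)} {t : ℝ}
    (ht : 0 ≤ t) (h : ∀ i, |u i - v i| ≤ t) : dist u v ≤ √n * t := by
  rw [EuclideanSpace.dist_eq]
  refine Real.sqrt_le_iff.mpr ⟨by positivity, ?_⟩
  rw [mul_pow, Real.sq_sqrt (by positivity)]
  calc ∑ i, dist (u i) (v i) ^ 2 ≤ ∑ _i : Fin n, t ^ 2 := by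
        gcongr with i
        exact h i
    _ = n * t ^ 2 := by simp

lemma EuclideanSpace.abs_sub_le_dist {n : ℕ} (u v : EuclideanSpace ℝ (Fin n)) (i : Fin n) :
    |u i - v i| ≤ dist u v := by
  rw [dist_eq_norm]
  exact PiLp.norm_apply_le (u - v) i

/-- A Lipschitz light map from `X` to `ℝⁿ` induces one from any snowflake of `X` to `ℝⁿ`. -/
theorem LipschitzLightWith.exists_snowflake {X : Type*} (m : MetricSpace X) {ε : ℝ}
    (h0 : 0 < ε) (h1 : ε < 1) {n : ℕ} {C : ℝ} (hC : 0 < C) {f : X → EuclideanSpace ℝ (Fin n)}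
    (hf : LipschitzLightWith C f) :
    ∃ C' : ℝ, 0 < C' ∧ ∃ g : X → EuclideanSpace ℝ (Fin n),
      @LipschitzLightWith _ _ (Snowflake m h0 h1.le).toPseudoMetricSpace _ C' g := by
  obtain ⟨F, H, K, hH, hK, hF, hlight⟩ := exists_holder_light h0 h1
  obtain ⟨hlip, hcomp⟩ := hf
  set E := (√n * K + 1) * max C 1 with hE
  have hC1 : (1 : ℝ) ≤ max C 1 := le_max_right _ _
  have hE1 : 1 ≤ E := by
    have : 0 ≤ √n * K := by positivity
    nlinarith
  have hE0 : 0 < E := by linarith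
  have hdist (x y : X) : @dist X (Snowflake m h0 h1.le).toPseudoMetricSpace.toDist x y
      = dist x y ^ ε := rfl
  refine ⟨max (√n * (H * C ^ ε)) ((C * E) ^ ε), lt_max_of_lt_right (by positivity),
    fun x => WithLp.toLp 2 fun i => F (f x i), ?_, ?_⟩
  · intro x y
    rw [hdist]
    refine (EuclideanSpace.dist_le_sqrt_mul (t := H * C ^ ε * dist x y ^ ε) (by positivity)
      fun i => ?_).trans ?_
    · refine (hF _ _).trans ?_
      rw [mul_assoc, ← Real.mul_rpow hC.le dist_nonneg]
      have := (EuclideanSpace.abs_sub_le_dist (f x) (f y) i).trans (hlip x y)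
      gcongr
    · rw [← mul_assoc]
      gcongr
      exact le_max_left _ _
  · rintro r hr W hW x y ⟨l, ⟨hlW, hl⟩, hx, hy⟩
    set s := r ^ ε⁻¹ with hs
    have hs0 : 0 < s := by positivity
    have hsr : s ^ ε = r := Real.rpow_inv_rpow hr.le h0.ne'
    have hl' : l.IsChain (fun a b => dist a b ≤ s) := by
      refine List.IsChain.imp (fun a b hab => ?_) hl
      rw [hdist] at hab
      rwa [hs, Real.le_rpow_inv_iff_of_pos dist_nonneg hr.le h0]
    have hxl : x ∈ l := List.mem_of_mem_head? hx
    have hyl : y ∈ l := List.mem_of_mem_getLast? hy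
    have hcoord (i : Fin n) : ∀ a ∈ l, ∀ b ∈ l, |f a i - f b i| ≤ K * (max C 1 * s) := by
      refine hlight X (fun x => f x i) (max C 1 * s) (by positivity) l ?_ ?_
      · refine List.IsChain.imp (fun a b hab => ?_) hl'
        refine (EuclideanSpace.abs_sub_le_dist (f a) (f b) i).trans ((hlip a b).trans ?_)
        gcongr
        exact le_max_left _ _
      · intro a ha b hb
        have hab := (Metric.edist_le_ediam_of_mem (mem_preimage.mp (hlW a ha))
          (mem_preimage.mp (hlW b hb))).trans hW
        rw [edist_le_ofReal hr.le] at hab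
        refine (EuclideanSpace.abs_sub_le_dist _ _ i).trans (hab.trans ?_)
        rw [← hsr]
        gcongr
        exact le_mul_of_one_le_left hs0.le hC1
    have hfl : ∀ a ∈ l, ∀ b ∈ l, dist (f a) (f b) ≤ E * s := by
      intro a ha b hb
      refine (EuclideanSpace.dist_le_sqrt_mul (by positivity) fun i => hcoord i a ha b hb).trans ?_
      have : 0 ≤ max C 1 * s := by positivity
      rw [hE]
      linarith
    have hxy : dist x y ≤ C * (E * s) := by
      refine hcomp (E * s) (by positivity) (f '' {z | z ∈ l}) ?_ x y
        ⟨l, ⟨fun z hz => ⟨z, hz, rfl⟩, ?_⟩, hx, hy⟩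
      · refine Metric.ediam_le ?_
        rintro _ ⟨a, ha, rfl⟩ _ ⟨b, hb, rfl⟩
        rw [edist_le_ofReal (by positivity)]
        exact hfl a ha b hb
      · exact List.IsChain.imp (fun a b hab => hab.trans (le_mul_of_one_le_left hs0.le hE1)) hl'
    rw [hdist]
    calc dist x y ^ ε ≤ (C * (E * s)) ^ ε := by gcongr
      _ = (C * E) ^ ε * r := by rw [← mul_assoc, Real.mul_rpow (by positivity) hs0.le, hsr]
      _ ≤ _ := by
        gcongr
        exact le_max_right _ _

/-- Snowflaking cannot increase the Lipschitz dimension: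
`dim_L(X, d^ε) ≤ dim_L(X, d)` for every `ε ∈ (0,1)`. -/
theorem lipschitzDim_snowflake_le (X : Type*) (m : MetricSpace X)
    (ε : ℝ) (hε0 : 0 < ε) (hε1 : ε < 1) :
    @lipschitzDim X (Snowflake m hε0 hε1.le).toPseudoMetricSpace
      ≤ @lipschitzDim X m.toPseudoMetricSpace := by
  refine sInf_le_sInf (Set.image_mono ?_)
  rintro n ⟨C, hC, f, hf⟩
  exact hf.exists_snowflake m hε0 hε1 hC
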